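/- Let K/k be a global function field of characteristic p, let t ∈ K be a separating element, and let v ∈ ℙ_K be a place which does not ramify in the extension K/k(t). Then the completion (K̂_v, v̂) satisfies UR(t): for every s ∈ K̂_v, either v̂(t − sᵖ) ≤ 0 or t − sᵖ is a uniformiser of v̂. (Only finitely many places of K ramify over k(t).) -/

import Mathlib

open FirstOrder Language

/-- The language with a single unary relation symbol `𝒪`. -/
def LO : Language :=
  ⟨fun _ => Empty, fun n => match n with | 1 => PUnit | _ => Empty⟩

/-- The one-sorted language of valued fields `𝔏_val = 𝔏_ring ∪ {𝒪}`. -/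
def Lval : Language := Language.ring.sum LO

/-- The `LO`-structure on a type given by a subset interpreting `𝒪`. -/
def LOStructure {F : Type*} (O : Set F) : LO.Structure F where
  funMap := fun f _ => f.elim
  RelMap := fun {n} r x =>
    match n, r, x with
    | 1, _, x => x 0 ∈ O

/-- The canonical `ring`-structure on a field. -/
noncomputable def ringStructure (F : Type*) [Field F] : Language.ring.Structure F :=
  (Ring.compatibleRingOfRing F).toStructure

/-- The `Lval`-structure of a valued field, `𝒪` interpreted as the valuation ring. -/
noncomputable def valStructure (F : Type*) [Field F] (O : ValuationSubring F) :
    Lval.Structure F :=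
  letI := ringStructure F
  letI := LOStructure (O : Set F)
  Language.sumStructure _ _ F

/-- The `Lval[[C]]`-structure of a valued field with constants interpreted via `ι`. -/
noncomputable def valCStructure (C : Type*) (F : Type*) [Field F] (ι : C → F)
    (O : ValuationSubring F) : (Lval[[C]]).Structure F :=
  letI := valStructure F O
  letI := constantsOn.structure ι
  Language.sumStructure _ _ F

/-- The `ring[[C]]`-structure on a field with constants interpreted via `ι`. -/
noncomputable def ringCStructure (C : Type*) (F : Type*) [Field F] (ι : C → F) :
    (Language.ring[[C]]).Structure F :=
  letI := ringStructure F
  letI := constantsOn.structure ι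
  Language.sumStructure _ _ F

/-- Satisfaction of an `𝔏_val`-sentence in a valued field. -/
def SatV {F : Type*} [Field F] (O : ValuationSubring F) (φ : Lval.Sentence) : Prop :=
  letI := valStructure F O
  F ⊨ φ

/-- Satisfaction of an `𝔏_val(C)`-sentence in a valued field with constants `ι`. -/
def SatVC (C : Type*) {F : Type*} [Field F] (ι : C → F) (O : ValuationSubring F)
    (φ : (Lval[[C]]).Sentence) : Prop :=
  letI := valCStructure C F ι O
  F ⊨ φ

/-- Satisfaction of an `𝔏_ring`-sentence in a field. -/
def SatR (F : Type*) [Field F] (φ : Language.ring.Sentence) : Prop :=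
  letI := ringStructure F
  F ⊨ φ

/-- Satisfaction of an `𝔏_ring(C)`-sentence in a field with constants `ι`. -/
def SatRC (C : Type*) (F : Type*) [Field F] (ι : C → F)
    (φ : (Language.ring[[C]]).Sentence) : Prop :=
  letI := ringCStructure C F ι
  F ⊨ φ

/-- An existential sentence: a quantifier-free formula with all variables
existentially quantified. -/
def IsExistentialSen {L : Language} (φ : L.Sentence) : Prop :=
  ∃ (n : ℕ) (ψ : L.BoundedFormula Empty n), ψ.IsQF ∧ φ = ψ.exs

/-- A universal sentence. -/
def IsUniversalSen {L : Language} (φ : L.Sentence) : Prop :=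
  ∃ (n : ℕ) (ψ : L.BoundedFormula Empty n), ψ.IsQF ∧ φ = ψ.alls

/-- A universal/existential sentence: a finite conjunction/disjunction combination of
existential and universal sentences. -/
inductive IsUE {L : Language} : L.Sentence → Prop
  | ex {φ} : IsExistentialSen φ → IsUE φ
  | all {φ} : IsUniversalSen φ → IsUE φ
  | inf {φ ψ} : IsUE φ → IsUE ψ → IsUE (φ ⊓ ψ)
  | sup {φ ψ} : IsUE φ → IsUE ψ → IsUE (φ ⊔ ψ)
/-- A place of a function field `K` over `k` (given by `ι : k →+* K`): a nontrivial
valuation subring of `K` containing (the image of) `k`. -/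
def IsPlace {k K : Type*} [Field k] [Field K] (ι : k →+* K) (O : ValuationSubring K) : Prop :=
  O ≠ ⊤ ∧ ∀ c, ι c ∈ O

/-- `K/k` is a function field of one variable: finitely generated of transcendence
degree 1 (equivalently, finite over `k(t)` for some transcendental `t`), with `k`
relatively algebraically closed in `K`. -/
structure IsFunctionField (k K : Type*) [Field k] [Field K] [Algebra k K] : Prop where
  exists_primitive : ∃ t : K, Transcendental k t ∧
    FiniteDimensional ↥(IntermediateField.adjoin k {t}) K
  constants_closed : ∀ x : K, IsAlgebraic k x → ∃ c : k, algebraMap k K c = x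

section Completion

variable (K : Type*) [Field K] (v : ValuationSubring K)

/-- The completion `K̂_v` of the valued field `(K, v)`. -/
noncomputable def Cmpl : Type _ :=
  letI := Valued.mk' v.valuation
  UniformSpace.Completion K

noncomputable instance : Field (Cmpl K v) :=
  letI := Valued.mk' v.valuation
  UniformSpace.Completion.instField

/-- The valuation ring of the canonical extension of `v` to the completion `K̂_v`. -/
noncomputable def cmplO : ValuationSubring (Cmpl K v) := by
  letI := Valued.mk' v.valuation
  letI : Field (UniformSpace.Completion K) := UniformSpace.Completion.instField
  letI : Valued (UniformSpace.Completion K) v.ValueGroup := Valued.valuedCompletion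
  exact (Valued.v : Valuation (UniformSpace.Completion K) v.ValueGroup).valuationSubring

/-- The canonical embedding of `K` into its completion `K̂_v`. -/
noncomputable def cmplEmb : K →+* Cmpl K v := by
  letI := Valued.mk' v.valuation
  letI : Field (UniformSpace.Completion K) := UniformSpace.Completion.instField
  exact UniformSpace.Completion.coeRingHom

end Completion

section Residue

variable {F : Type*} [Field F] (O : ValuationSubring F)

/-- The residue field `Fv` of a valued field. -/
noncomputable abbrev ResF := IsLocalRing.ResidueField ↥O

/-- The interpretation of constants from `C` in the residue field, via the residue map. -/
noncomputable def resConst {C : Type*} (ι : C → F) (h : ∀ c, ι c ∈ O) :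
    C → ResF O :=
  fun c => IsLocalRing.residue _ ⟨ι c, h c⟩

/-- The interpretation of constants from `C` in the residue field, via the residue map,
extended by `0` outside the valuation ring. -/
noncomputable def resConstExt {C : Type*} (ι : C → F) : C → ResF O :=
  open scoped Classical in
  fun c => if h : ι c ∈ O then IsLocalRing.residue _ ⟨ι c, h⟩ else 0

end Residue

/-- A field is pseudofinite if it is infinite and models the first-order theory of
the class of all finite fields. -/
def IsPseudofinite (F : Type*) [Field F] : Prop :=
  Infinite F ∧ ∀ φ : Language.ring.Sentence,
    (∀ (E : Type) (_ : Field E) (_ : Finite E), SatR E φ) → SatR F φ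
section Places

variable (k K : Type) [Field k] [Field K] [Algebra k K]

/-- The set `ℙ_K` of places of the function field `K/k`. -/
def Places : Type :=
  {O : ValuationSubring K // IsPlace (algebraMap k K) O}

variable {k K}

/-- Satisfaction of an `𝔏_val`-sentence in the completion `K̂_v` at a place `v ∈ ℙ_K`. -/
def SatCmpl (v : Places k K) (φ : Lval.Sentence) : Prop :=
  SatV (cmplO K v.1) φ

/-- Satisfaction of an `𝔏_val(K)`-sentence in the completion `K̂_v` at a place `v ∈ ℙ_K`,
the constants from `K` being interpreted via the canonical embedding `K → K̂_v`. -/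
def SatCmplC (v : Places k K) (φ : (Lval[[K]]).Sentence) : Prop :=
  SatVC K (⇑(cmplEmb K v.1)) (cmplO K v.1) φ

/-- Satisfaction of an `𝔏_ring`-sentence in the residue field `Kv` at a place `v ∈ ℙ_K`. -/
def SatRes (v : Places k K) (ψ : Language.ring.Sentence) : Prop :=
  SatR (ResF v.1) ψ

/-- Satisfaction of an `𝔏_ring(K)`-sentence in the residue field `Kv` at a place `v ∈ ℙ_K`,
the constants from `K` being interpreted via the residue map. -/
def SatResC (v : Places k K) (ψ : (Language.ring[[K]]).Sentence) : Prop :=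
  SatRC K (ResF v.1) (resConstExt v.1 id) ψ

end Places

/-- `(F, O)` is an equicharacteristic henselian nontrivially valued field. -/
def EqHensNontriv (F : Type) [Field F] (O : ValuationSubring F) : Prop :=
  HenselianLocalRing ↥O ∧ O ≠ ⊤ ∧ ringChar F = ringChar (ResF O)
/-- The residue ring homomorphism `C →+* Fv` of a valued field extending the trivially
valued field `C`. -/
noncomputable def resRingHom {F : Type*} [Field F] (O : ValuationSubring F) {C : Type*}
    [Field C] (ι : C →+* F) (h : ∀ c, ι c ∈ O) : C →+* ResF O :=
  (IsLocalRing.residue ↥O).comp (ι.codRestrict O h)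

/-- `C` has imperfect exponent at most `1`, i.e. `[C : Cᵖ] ≤ p` in characteristic `p`
(no condition in characteristic `0`). -/
def ImperfectExpLEOne (C : Type*) [Field C] : Prop :=
  ∀ p : ℕ, p.Prime → ringChar C = p →
    Module.rank ↥(Subfield.closure {x : C | ∃ y : C, y ^ p = x}) C ≤ p

/-- The field extension `F/C` (along `ι`) is separable: its base change to every field
extension of `C` is reduced. -/
def SeparableExt {C F : Type*} [Field C] [Field F] (ι : C →+* F) : Prop :=
  ∀ (E : Type) (_ : Field E) (j : C →+* E),
    letI := ι.toAlgebra
    letI := j.toAlgebra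
    IsReduced (TensorProduct C F E)
/-- `π` is a uniformiser for the valuation with valuation ring `O`: an element of minimal
positive value. -/
def IsUniformiser {F : Type*} [Field F] (O : ValuationSubring F) (π : F) : Prop :=
  O.valuation π < 1 ∧ ∀ y : F, O.valuation y < 1 → O.valuation y ≤ O.valuation π

/-- The property `UR(t)` of a valued field of characteristic `p` containing `t`:
for every `s`, the element `t - sᵖ` has non-positive value or is a uniformiser. -/
def URt {F : Type*} [Field F] (O : ValuationSubring F) (p : ℕ) (t : F) : Prop :=
  ∀ s : F, 1 ≤ O.valuation (t - s ^ p) ∨ IsUniformiser O (t - s ^ p)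

/-- `L` is existentially closed in `F` along the embedding `j`: every existential
`𝔏_ring(L)`-sentence (with constants from `L`) true in `F` is true in `L`. -/
def ExistentiallyClosedIn {L F : Type} [Field L] [Field F] (j : L →+* F) : Prop :=
  ∀ φ : (Language.ring[[L]]).Sentence, IsExistentialSen φ →
    SatRC L F (⇑j) φ → SatRC L L id φ

/-- The axiom (R4): every field `L` existentially closed in `L((t))` is existentially
closed in every extension `F/L` admitting a valuation trivial on `L` with residue
field `L`. -/
def R4 : Prop :=
  ∀ (L : Type) (_ : Field L),
    ExistentiallyClosedIn (algebraMap L (LaurentSeries L)) →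
    ∀ (F : Type) (_ : Field F) (j : L →+* F),
      (∃ (O : ValuationSubring F) (h : ∀ x : L, j x ∈ O),
        (∀ x : L, x ≠ 0 → (j x)⁻¹ ∈ O) ∧
        Function.Surjective ⇑(resRingHom O j h)) →
      ExistentiallyClosedIn j

/-- `t` is a separating element of the function field `K/k`:
`K/k(t)` is finite and separable. -/
def IsSeparating (k : Type*) {K : Type*} [Field k] [Field K] [Algebra k K] (t : K) : Prop :=
  Transcendental k t ∧ FiniteDimensional ↥(IntermediateField.adjoin k {t}) K ∧
    Algebra.IsSeparable ↥(IntermediateField.adjoin k {t}) K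

/-- The place `O` of `K` is unramified over the rational subfield `k(t)`:
some element of `k(t)` is a uniformiser for `O` (i.e. the ramification index is `1`). -/
def UnramifiedOver (k : Type*) {K : Type*} [Field k] [Field K] [Algebra k K] (t : K)
    (O : ValuationSubring K) : Prop :=
  ∃ d : K, d ∈ IntermediateField.adjoin k {t} ∧ IsUniformiser O d

theorem cmplO_valuation_le_iff {K : Type*} [Field K] (v : ValuationSubring K) (x y : K) :
    (cmplO K v).valuation (cmplEmb K v x) ≤ (cmplO K v).valuation (cmplEmb K v y) ↔
      v.valuation x ≤ v.valuation y := by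
  let := Valued.mk' v.valuation
  let : Valued (UniformSpace.Completion K) v.ValueGroup := Valued.valuedCompletion
  have h := Valuation.isEquiv_valuation_valuationSubring
    (Valued.v : Valuation (UniformSpace.Completion K) v.ValueGroup)
  refine (h (x : UniformSpace.Completion K) (y : UniformSpace.Completion K)).symm.trans ?_
  rw [Valued.valuedCompletion_apply, Valued.valuedCompletion_apply]
  rfl

theorem exists_cmplO_valuation_eq {K : Type*} [Field K] (v : ValuationSubring K) (y : Cmpl K v) :
    ∃ x : K, (cmplO K v).valuation y = (cmplO K v).valuation (cmplEmb K v x) := by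
  let := Valued.mk' v.valuation
  let : Valued (UniformSpace.Completion K) v.ValueGroup := Valued.valuedCompletion
  have h := Valuation.isEquiv_valuation_valuationSubring
    (Valued.v : Valuation (UniformSpace.Completion K) v.ValueGroup)
  obtain ⟨x, hx⟩ := Valued.exists_coe_eq_v (K := K) y
  refine ⟨x, ?_⟩
  refine (h.eq_iff (r := y) (s := (x : UniformSpace.Completion K))).1 ?_
  rw [Valued.valuedCompletion_apply]
  exact hx

theorem IsUniformiser.cmplEmb {K : Type*} [Field K] {v : ValuationSubring K} {d : K}
    (hd : IsUniformiser v d) : IsUniformiser (cmplO K v) (cmplEmb K v d) := by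
  have key (x : K) :
      (cmplO K v).valuation (_root_.cmplEmb K v x) < 1 ↔ v.valuation x < 1 := by
    have := cmplO_valuation_le_iff v 1 x
    rw [map_one, map_one, map_one] at this
    simpa using not_congr this
  refine ⟨(key d).2 hd.1, fun y hy ↦ ?_⟩
  obtain ⟨x, hx⟩ := exists_cmplO_valuation_eq v y
  rw [hx] at hy ⊢
  exact (cmplO_valuation_le_iff v x d).2 (hd.2 x ((key x).1 hy))

theorem cmplEmb_mem_cmplO {K : Type*} [Field K] {v : ValuationSubring K} {x : K} (hx : x ∈ v) :
    cmplEmb K v x ∈ cmplO K v := by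
  rw [← ValuationSubring.valuation_le_one_iff] at hx ⊢
  have := cmplO_valuation_le_iff v x 1
  simp only [map_one] at this
  exact this.2 hx

theorem IsUniformiser.ne_zero {F : Type*} [Field F] {O : ValuationSubring F} {d : F}
    (hO : O ≠ ⊤) (hd : IsUniformiser O d) : d ≠ 0 := by
  rintro rfl
  refine hO (eq_top_iff.2 fun x _ ↦ ?_)
  rw [← ValuationSubring.valuation_le_one_iff]
  by_contra! h
  have h2 := hd.2 x⁻¹ (by rw [map_inv₀]; exact inv_lt_one_of_one_lt₀ h)
  rw [map_zero, le_zero_iff, map_eq_zero, inv_eq_zero] at h2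
  simp [h2] at h

open Polynomial in
/-- A uniformiser in `k(t)` has the same value as some polynomial in `t`, if `t` is integral. -/
theorem exists_isUniformiser_aeval {k F : Type*} [Field k] [Field F] [Algebra k F]
    {O : ValuationSubring F} (hk : ∀ c, algebraMap k F c ∈ O) {t d : F} (htO : t ∈ O)
    (hd : d ∈ IntermediateField.adjoin k {t}) (hu : IsUniformiser O d) (hd0 : d ≠ 0) :
    ∃ f : k[X], IsUniformiser O (aeval t f) := by
  have haO (a : k[X]) : aeval t a ∈ O := by
    rw [aeval_eq_sum_range]
    refine sum_mem fun i _ ↦ ?_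
    rw [Algebra.smul_def]
    exact mul_mem (hk _) (pow_mem htO _)
  let ev : k[X] →+* O := (aeval t : k[X] →ₐ[k] F).toRingHom.codRestrict O haO
  have hev (a : k[X]) : ev a ∈ IsLocalRing.maximalIdeal O ↔ O.valuation (aeval t a) < 1 :=
    O.valuation_lt_one_iff (ev a)
  let P := (IsLocalRing.maximalIdeal O).comap ev
  have hP : P.IsPrime := inferInstance
  have hPmem (a : k[X]) : a ∈ P ↔ O.valuation (aeval t a) < 1 := hev a
  obtain ⟨f, hf⟩ := IsPrincipalIdealRing.principal P
  rw [Ideal.submodule_span_eq] at hf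
  have hγ : O.valuation (aeval t f) < 1 := (hPmem f).1 (hf ▸ Ideal.mem_span_singleton_self f)
  have hval (a : k[X]) (ha : a ≠ 0) :
      ∃ n : ℕ, O.valuation (aeval t a) = O.valuation (aeval t f) ^ n := by
    have hunit (u : k[X]) (h : u ∉ P) : O.valuation (aeval t u) = 1 :=
      le_antisymm ((O.valuation_le_one_iff _).2 (haO u)) (not_lt.1 fun h' ↦ h ((hPmem u).2 h'))
    by_cases hf0 : f = 0
    · refine ⟨0, ?_⟩
      rw [pow_zero]
      refine hunit a ?_
      rw [hf, hf0, Ideal.mem_span_singleton, zero_dvd_iff]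
      exact ha
    have hfp : Prime f := (Ideal.span_singleton_prime hf0).1 (hf ▸ hP)
    obtain ⟨u, hau, hfu⟩ :=
      (FiniteMultiplicity.of_prime_left hfp ha).exists_eq_pow_mul_and_not_dvd
    refine ⟨multiplicity f a, ?_⟩
    nth_rw 1 [hau]
    rw [map_mul, map_mul, map_pow, map_pow, hunit u, mul_one]
    rwa [hf, Ideal.mem_span_singleton]
  obtain ⟨a, b, rfl⟩ := (IntermediateField.mem_adjoin_simple_iff k d).1 hd
  obtain ⟨ha, hb⟩ := div_ne_zero_iff.1 hd0
  obtain ⟨n, hn⟩ := hval a (by rintro rfl; simp at ha)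
  obtain ⟨m, hm⟩ := hval b (by rintro rfl; simp at hb)
  refine ⟨f, hγ, fun y hy ↦ (hu.2 y hy).trans ?_⟩
  have hb' : O.valuation (aeval t b) ≠ 0 := by simpa using hb
  have h1 := hu.1
  rw [map_div₀, hn, hm] at h1 ⊢
  rw [hm] at hb'
  have hlt : O.valuation (aeval t f) ^ n < O.valuation (aeval t f) ^ m := by
    rwa [div_lt_one₀ (zero_lt_iff.2 hb')] at h1
  have hmn : m < n := by
    by_contra! h
    exact absurd (pow_le_pow_right_of_le_one' hγ.le h) (not_le.2 hlt)
  rw [div_le_iff₀ (zero_lt_iff.2 hb'), ← pow_succ']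
  exact pow_le_pow_right_of_le_one' hγ.le hmn

open Polynomial in
theorem URt_of_mem {k F : Type*} [Field k] [Field F] [Algebra k F] {p : ℕ} [Fact p.Prime]
    [CharP k p] [PerfectRing k p]
    {O : ValuationSubring F} (hk : ∀ c, algebraMap k F c ∈ O) {t d : F} (htO : t ∈ O)
    (hd : d ∈ IntermediateField.adjoin k {t}) (hu : IsUniformiser O d) (hd0 : d ≠ 0) :
    URt O p t := by
  intro s
  by_contra! ⟨hlt, hnot⟩
  obtain ⟨f, hf⟩ := exists_isUniformiser_aeval hk htO hd hu hd0
  have hp : p.Prime := Fact.out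
  have hspO : s ^ p ∈ O := by
    have := O.sub_mem htO ((O.valuation_le_one_iff _).1 hlt.le)
    simpa using this
  have hroot : aeval (s ^ p) f = aeval s (f.map (frobeniusEquiv k p).symm.toRingHom) ^ p := by
    rw [← map_pow, ← map_frobenius_expand, ← expand_aeval, map_expand, Polynomial.map_map]
    congr 3
    exact (RingHom.ext fun x ↦ by simp : (frobenius k p).comp
      (frobeniusEquiv k p).symm.toRingHom = RingHom.id k) ▸ (Polynomial.map_id (p := f)).symm
  set e := aeval s (f.map (frobeniusEquiv k p).symm.toRingHom)
  let φ : k →+* O := (algebraMap k F).codRestrict O hk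
  have hφ (x : O) : (((f.map φ).eval x : O) : F) = aeval (x : F) f := by
    rw [aeval_def, ← eval_map, eval_map, eval_map]
    exact hom_eval₂ f φ O.subtype x
  obtain ⟨w, hw⟩ := Polynomial.sub_dvd_eval_sub (⟨t, htO⟩ : O) ⟨s ^ p, hspO⟩ (f.map φ)
  have hw' : aeval t f - e ^ p = (t - s ^ p) * w := by
    have := congrArg (Subtype.val) hw
    rw [← hroot]
    push_cast at this
    rwa [hφ, hφ] at this
  have hle : O.valuation ((t - s ^ p) * w) ≤ O.valuation (t - s ^ p) := by
    rw [map_mul]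
    exact mul_le_of_le_one_right' (O.valuation_le_one w)
  have hep : O.valuation e ^ p < 1 := by
    rw [← map_pow, show e ^ p = aeval t f - (t - s ^ p) * w by rw [← hw']; ring]
    exact (Valuation.map_sub _ _ _).trans_lt (max_lt hf.1 (hle.trans_lt hlt))
  have he : O.valuation e < 1 := (pow_lt_one_iff hp.ne_zero).1 hep
  have hf0 : O.valuation (aeval t f) ≠ 0 := by
    intro h
    have := hf.2 d hu.1
    rw [h, le_zero_iff, map_eq_zero] at this
    exact hd0 this
  have hep' : O.valuation (e ^ p) < O.valuation (aeval t f) := by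
    rw [map_pow]
    calc O.valuation e ^ p ≤ O.valuation e ^ 2 := pow_le_pow_right_of_le_one' he.le hp.two_le
      _ ≤ O.valuation (aeval t f) ^ 2 := by gcongr; exact hf.2 e he
      _ = O.valuation (aeval t f) * O.valuation (aeval t f) := sq _
      _ < O.valuation (aeval t f) := mul_lt_of_lt_one_right (zero_lt_iff.2 hf0) hf.1
  refine hnot ⟨hlt, fun y hy ↦ (hf.2 y hy).trans ?_⟩
  rw [← Valuation.map_sub_eq_of_lt_left _ hep', hw']
  exact hle

theorem URt_of_mem_adjoin {k F : Type*} [Field k] [Field F] [Algebra k F] {p : ℕ} [Fact p.Prime]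
    [CharP k p] [PerfectRing k p]
    {O : ValuationSubring F} (hk : ∀ c, algebraMap k F c ∈ O) {t d : F}
    (hd : d ∈ IntermediateField.adjoin k {t}) (hu : IsUniformiser O d) (hd0 : d ≠ 0) :
    URt O p t := by
  by_cases htO : t ∈ O
  · exact URt_of_mem hk htO hd hu hd0
  have hp : p.Prime := Fact.out
  have htv : 1 < O.valuation t := by
    rwa [← ValuationSubring.valuation_le_one_iff, not_le] at htO
  have ht0 : t ≠ 0 := by rintro rfl; simp at htv
  have hinv : O.valuation t⁻¹ < 1 := by rw [map_inv₀]; exact inv_lt_one_of_one_lt₀ htv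
  have hd' : d ∈ IntermediateField.adjoin k {t⁻¹} := by
    refine IntermediateField.adjoin_le_iff.2 ?_ hd
    rw [Set.singleton_subset_iff]
    simpa using inv_mem (IntermediateField.mem_adjoin_simple_self k t⁻¹)
  have hUR := URt_of_mem (p := p) hk ((O.valuation_le_one_iff _).1 hinv.le) hd' hu hd0
  intro s
  by_contra! ⟨hlt, -⟩
  have hs : O.valuation (s ^ p) = O.valuation t :=
    (Valuation.map_eq_of_sub_lt _ (by rw [Valuation.map_sub_swap]; exact hlt.trans htv))
  have hs0 : s ≠ 0 := by
    rintro rfl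
    rw [zero_pow hp.ne_zero, map_zero] at hs
    simp [← hs] at htv
  have heq : O.valuation (t⁻¹ - s⁻¹ ^ p) =
      O.valuation (t - s ^ p) * (O.valuation t⁻¹ * O.valuation t⁻¹) := by
    have : t⁻¹ - s⁻¹ ^ p = (s ^ p - t) * (t⁻¹ * (s ^ p)⁻¹) := by
      have hsp : s ^ p ≠ 0 := pow_ne_zero _ hs0
      rw [inv_pow]
      field_simp
    rw [this, map_mul, map_mul, Valuation.map_sub_swap, map_inv₀ _ (s ^ p), hs, map_inv₀]
  have hd0' : 0 < O.valuation d := by simpa [zero_lt_iff] using hd0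
  have hsm : O.valuation (t⁻¹ - s⁻¹ ^ p) < O.valuation d := by
    rw [heq]
    calc _ ≤ O.valuation d * (O.valuation d * O.valuation d) := by
          gcongr <;> apply hu.2 <;> assumption
      _ < O.valuation d * 1 := by
          gcongr
          exact mul_lt_one_of_nonneg_of_lt_one_left zero_le hu.1 hu.1.le
      _ = _ := mul_one _
  rcases hUR s⁻¹ with h | h
  · exact absurd (h.trans hsm.le) (not_le.2 hu.1)
  · exact absurd (h.2 d hu.1) (not_le.2 hsm)

section Centre

variable {B K : Type*} [CommRing B] [Field K] [Algebra B K] (v : ValuationSubring K)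

/-- The centre on `B` of a valuation ring `v` containing `B`. -/
noncomputable def centre (hB : ∀ b, algebraMap B K b ∈ v) : Ideal B :=
  (IsLocalRing.maximalIdeal v).comap ((algebraMap B K).codRestrict v hB)

variable {v}

theorem mem_centre {hB : ∀ b, algebraMap B K b ∈ v} {b : B} :
    b ∈ centre v hB ↔ v.valuation (algebraMap B K b) < 1 :=
  v.valuation_lt_one_iff ((algebraMap B K).codRestrict v hB b)

instance {hB : ∀ b, algebraMap B K b ∈ v} : (centre v hB).IsPrime :=
  inferInstanceAs (Ideal.comap _ _).IsPrime

theorem valuation_eq_one_of_notMem_centre {hB : ∀ b, algebraMap B K b ∈ v} {b : B}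
    (hb : b ∉ centre v hB) : v.valuation (algebraMap B K b) = 1 :=
  le_antisymm ((v.valuation_le_one_iff _).2 (hB b)) (not_lt.1 fun h ↦ hb (mem_centre.2 h))

theorem centre_ne_bot [IsDomain B] [IsFractionRing B K] (hv : v ≠ ⊤)
    (hB : ∀ b, algebraMap B K b ∈ v) : centre v hB ≠ ⊥ := by
  intro h
  refine hv (eq_top_iff.2 fun x _ ↦ ?_)
  obtain ⟨a, b, hb, rfl⟩ := IsFractionRing.div_surjective (A := B) x
  rw [← ValuationSubring.valuation_le_one_iff, map_div₀,
    valuation_eq_one_of_notMem_centre (hB := hB) (b := b), div_one]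
  · exact (v.valuation_le_one_iff _).2 (hB a)
  · rw [h, Ideal.mem_bot]
    exact nonZeroDivisors.ne_zero hb

theorem exists_div_notMem_centre [IsDedekindDomain B] [IsFractionRing B K] (hv : v ≠ ⊤)
    (hB : ∀ b, algebraMap B K b ∈ v) {x : K} (hx : x ∈ v) :
    ∃ a b : B, b ∉ centre v hB ∧ algebraMap B K a / algebraMap B K b = x := by
  have hinj := IsFractionRing.injective B K
  have hdvr := IsLocalization.AtPrime.isDiscreteValuationRing_of_dedekind_domain B
    (centre_ne_bot hv hB) (Localization.AtPrime (centre v hB))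
  have hloc {a b : B} (h : algebraMap B (Localization.AtPrime (centre v hB)) a ∣
      algebraMap B (Localization.AtPrime (centre v hB)) b) :
      ∃ s c : B, s ∉ centre v hB ∧ b * s = a * c := by
    obtain ⟨z, hz⟩ := h
    obtain ⟨⟨c, s⟩, hcs⟩ := IsLocalization.surj (centre v hB).primeCompl z
    refine ⟨s, c, s.2, ?_⟩
    refine IsLocalization.injective (Localization.AtPrime (centre v hB))
      (centre v hB).primeCompl_le_nonZeroDivisors ?_
    rw [map_mul, map_mul, hz, mul_assoc, hcs]
  obtain ⟨a, b, hb, rfl⟩ := IsFractionRing.div_surjective (A := B) x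
  have hb0 : algebraMap B K b ≠ 0 := by
    simpa using nonZeroDivisors.ne_zero hb
  rcases ValuationRing.dvd_total (algebraMap B (Localization.AtPrime (centre v hB)) b)
    (algebraMap B (Localization.AtPrime (centre v hB)) a) with h | h
  · obtain ⟨s, c, hs, h⟩ := hloc h
    refine ⟨c, s, hs, ?_⟩
    have hs0 : algebraMap B K s ≠ 0 := by
      intro h0
      have := valuation_eq_one_of_notMem_centre hs
      simp [h0] at this
    rw [div_eq_div_iff hs0 hb0, ← map_mul, ← map_mul, h, mul_comm]
  · obtain ⟨s, c, hs, h⟩ := hloc h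
    have hsv := valuation_eq_one_of_notMem_centre hs
    have hc : c ∉ centre v hB := by
      intro hc
      rw [mem_centre] at hc
      have h1 : algebraMap B K s = algebraMap B K a / algebraMap B K b * algebraMap B K c := by
        rw [div_mul_eq_mul_div, eq_div_iff hb0, ← map_mul, ← map_mul, ← h, mul_comm]
      rw [h1, map_mul] at hsv
      exact absurd hsv (mul_lt_one_of_nonneg_of_lt_one_right
        ((v.valuation_le_one_iff _).2 hx) zero_le hc).ne
    have hc0 : algebraMap B K c ≠ 0 := by
      intro h0
      have := valuation_eq_one_of_notMem_centre hc
      simp [h0] at this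
    refine ⟨s, c, hc, ?_⟩
    rw [div_eq_div_iff hc0 hb0, ← map_mul, ← map_mul, ← h, mul_comm]

theorem finite_valuationSubring_lt_one [IsDedekindDomain B] [IsFractionRing B K] {b : B}
    (hb : b ≠ 0) :
    {v : ValuationSubring K | v ≠ ⊤ ∧ (∀ b, algebraMap B K b ∈ v) ∧
      v.valuation (algebraMap B K b) < 1}.Finite := by
  refine Set.Finite.of_finite_image
    (f := fun v : ValuationSubring K ↦ {b : B | v.valuation (algebraMap B K b) < 1}) ?_ ?_
  · have hfin := Ideal.finite_factors (I := Ideal.span {b}) (by simpa using hb)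
    refine (hfin.image fun P ↦ (P.asIdeal : Set B)).subset ?_
    rintro _ ⟨v, ⟨hv, hB, hvb⟩, rfl⟩
    refine ⟨⟨centre v hB, inferInstance, centre_ne_bot hv hB⟩, ?_, ?_⟩
    · rw [Set.mem_ofPred_eq, Ideal.dvd_span_singleton]
      exact mem_centre.2 hvb
    · ext c
      exact mem_centre
  · have key {v w : ValuationSubring K} (hv : v ≠ ⊤) (hB : ∀ b, algebraMap B K b ∈ v)
        (hw : ∀ b, algebraMap B K b ∈ w)
        (h : {b : B | v.valuation (algebraMap B K b) < 1} =
          {b : B | w.valuation (algebraMap B K b) < 1}) : v ≤ w := by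
      intro x hx
      obtain ⟨a, b, hb, rfl⟩ := exists_div_notMem_centre hv hB hx
      have hb' : b ∉ centre w hw := fun hb' ↦ hb (mem_centre.2 (h.ge (mem_centre.1 hb')))
      rw [← ValuationSubring.valuation_le_one_iff, map_div₀,
        valuation_eq_one_of_notMem_centre hb', div_one]
      exact (w.valuation_le_one_iff _).2 (hw a)
    rintro v ⟨hv, hvB, -⟩ w ⟨hw, hwB, -⟩ h
    exact le_antisymm (key hv hvB hwB h) (key hw hwB hvB h.symm)

theorem exists_isUniformiser_of_isUnramifiedAt {A : Type*} [CommRing A] [IsPrincipalIdealRing A]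
    [Algebra A B] [Algebra A K] [IsScalarTower A B K] [Module.Finite A B]
    [IsDedekindDomain B] [IsFractionRing B K] (hv : v ≠ ⊤)
    (hB : ∀ b, algebraMap B K b ∈ v) (h : Algebra.IsUnramifiedAt A (centre v hB)) :
    ∃ f : A, IsUniformiser v (algebraMap A K f) := by
  obtain ⟨f, hf⟩ := IsPrincipalIdealRing.principal ((centre v hB).under A)
  rw [Ideal.submodule_span_eq] at hf
  let := Localization.AtPrime.algebraOfLiesOver ((centre v hB).under A) (centre v hB)
  have hmax := ((Algebra.isUnramifiedAt_iff_map_eq A ((centre v hB).under A)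
    (centre v hB)).1 h).2
  rw [hf, Ideal.map_span, Set.image_singleton] at hmax
  have hfv : v.valuation (algebraMap A K f) < 1 := by
    have : f ∈ (centre v hB).under A := hf ▸ Ideal.mem_span_singleton_self f
    rw [IsScalarTower.algebraMap_apply A B K]
    exact mem_centre.1 this
  refine ⟨f, hfv, fun y hy ↦ ?_⟩
  obtain ⟨a, b, hb, rfl⟩ := exists_div_notMem_centre hv hB ((v.valuation_le_one_iff _).1 hy.le)
  rw [map_div₀, valuation_eq_one_of_notMem_centre hb, div_one] at hy ⊢
  have ha : algebraMap B (Localization.AtPrime (centre v hB)) a ∈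
      IsLocalRing.maximalIdeal (Localization.AtPrime (centre v hB)) := by
    rw [IsLocalization.AtPrime.to_map_mem_maximal_iff _ (centre v hB)]
    exact mem_centre.2 hy
  rw [← hmax, Ideal.mem_span_singleton] at ha
  obtain ⟨z, hz⟩ := ha
  obtain ⟨⟨c, s⟩, hcs⟩ := IsLocalization.surj (centre v hB).primeCompl z
  have has : a * s = algebraMap A B f * c := by
    refine IsLocalization.injective (Localization.AtPrime (centre v hB))
      (centre v hB).primeCompl_le_nonZeroDivisors ?_
    rw [map_mul, map_mul, hz, mul_assoc, hcs, ← IsScalarTower.algebraMap_apply]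
  have := congrArg (fun x ↦ v.valuation (algebraMap B K x)) has
  simp only [map_mul] at this
  rw [valuation_eq_one_of_notMem_centre s.2, mul_one, ← IsScalarTower.algebraMap_apply] at this
  rw [this]
  exact mul_le_of_le_one_right' ((v.valuation_le_one_iff _).2 (hB c))

open scoped nonZeroDivisors in
attribute [local instance] FractionRing.liftAlgebra in
/-- Away from the zeros of a nonzero element of the different, places are unramified. -/
theorem exists_ne_zero_forall_isUniformiser (A L B K : Type*) [CommRing A] [IsDomain A]
    [IsPrincipalIdealRing A] [Field L] [CommRing B] [IsDedekindDomain B] [Field K] [Algebra A L]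
    [IsFractionRing A L] [Algebra A B] [Algebra B K] [IsFractionRing B K] [Algebra A K]
    [Algebra L K] [IsScalarTower A B K] [IsScalarTower A L K] [Module.Finite A B]
    [Module.IsTorsionFree A B] [Algebra.IsSeparable L K] :
    ∃ b : B, b ≠ 0 ∧ ∀ v : ValuationSubring K, v ≠ ⊤ → (∀ b, algebraMap B K b ∈ v) →
      ¬ v.valuation (algebraMap B K b) < 1 → ∃ f : A, IsUniformiser v (algebraMap A K f) := by
  have : Algebra.IsSeparable (FractionRing A) (FractionRing B) := by
    refine Algebra.IsSeparable.of_equiv_equiv (FractionRing.algEquiv A L).symm.toRingEquiv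
      (FractionRing.algEquiv B K).symm.toRingEquiv ?_
    ext _
    exact IsFractionRing.algEquiv_commutes (FractionRing.algEquiv A L).symm
      (FractionRing.algEquiv B K).symm _
  obtain ⟨b, hbD, hb0⟩ := Submodule.exists_mem_ne_zero_of_ne_bot
    (differentIdeal_ne_bot (A := A) (B := B))
  refine ⟨b, hb0, fun v hv hB hbv ↦ exists_isUniformiser_of_isUnramifiedAt hv hB ?_⟩
  rw [← not_dvd_differentIdeal_iff, Ideal.dvd_iff_le]
  exact fun hle ↦ hbv (mem_centre.1 (hle hbD))

end Centre

section FunctionField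

open scoped IntermediateField.algebraAdjoinAdjoin

variable {k K : Type*} [Field k] [Field K] [Algebra k K] {t : K}

theorem isPrincipalIdealRing_adjoin_singleton :
    IsPrincipalIdealRing (Algebra.adjoin k {t}) := by
  have hs : Function.Surjective (Polynomial.aeval (R := k) t).rangeRestrict :=
    (Polynomial.aeval (R := k) t).rangeRestrict_surjective
  rw [Algebra.adjoin_singleton_eq_range_aeval]
  exact IsPrincipalIdealRing.of_surjective _ hs

theorem integralClosure_adjoin_le {O : ValuationSubring K} (hk : ∀ c, algebraMap k K c ∈ O)
    (htO : t ∈ O) (b : integralClosure (Algebra.adjoin k {t}) K) : (b : K) ∈ O := by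
  have hA (a : Algebra.adjoin k {t}) : (a : K) ∈ O :=
    (Algebra.adjoin_le (S := { O.toSubring with algebraMap_mem' := hk })
      (Set.singleton_subset_iff.2 htO)) a.2
  obtain ⟨f, hf, hfb⟩ := b.2
  have : IsIntegral O (b : K) := by
    refine ⟨f.map ((Algebra.adjoin k {t}).val.toRingHom.codRestrict O hA), hf.map _, ?_⟩
    rw [Polynomial.eval₂_map]
    exact hfb
  obtain ⟨y, hy⟩ := IsIntegrallyClosed.isIntegral_iff.1 this
  exact hy ▸ y.2

theorem isDedekindDomain_integralClosure_adjoin (ht : IsSeparating k t) :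
    IsDedekindDomain (integralClosure (Algebra.adjoin k {t}) K) := by
  obtain ⟨-, hfd, hsep⟩ := ht
  have := isPrincipalIdealRing_adjoin_singleton (k := k) (t := t)
  exact integralClosure.isDedekindDomain (Algebra.adjoin k {t}) (IntermediateField.adjoin k {t}) K

theorem isFractionRing_integralClosure_adjoin (ht : IsSeparating k t) :
    IsFractionRing (integralClosure (Algebra.adjoin k {t}) K) K := by
  obtain ⟨-, hfd, hsep⟩ := ht
  exact integralClosure.isFractionRing_of_finite_extension
    (IntermediateField.adjoin k {t}) K

theorem finite_lt_one (ht : IsSeparating k t) {b : integralClosure (Algebra.adjoin k {t}) K}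
    (hb : b ≠ 0) :
    {v : ValuationSubring K | IsPlace (algebraMap k K) v ∧ t ∈ v ∧
      v.valuation (b : K) < 1}.Finite := by
  have := isDedekindDomain_integralClosure_adjoin ht
  have := isFractionRing_integralClosure_adjoin ht
  refine (finite_valuationSubring_lt_one (K := K) hb).subset ?_
  rintro v ⟨⟨hv, hk⟩, htv, hbv⟩
  exact ⟨hv, integralClosure_adjoin_le hk htv, hbv⟩

theorem finite_ramified_of_mem (ht : IsSeparating k t) :
    {v : ValuationSubring K | IsPlace (algebraMap k K) v ∧ t ∈ v ∧
      ¬ UnramifiedOver k t v}.Finite := by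
  have := isPrincipalIdealRing_adjoin_singleton (k := k) (t := t)
  have := isDedekindDomain_integralClosure_adjoin ht
  have := isFractionRing_integralClosure_adjoin ht
  have hfd := ht.2.1
  have hsep := ht.2.2
  have : Module.Finite (Algebra.adjoin k {t}) (integralClosure (Algebra.adjoin k {t}) K) :=
    IsIntegralClosure.finite (Algebra.adjoin k {t}) (IntermediateField.adjoin k {t}) K _
  obtain ⟨b, hb0, hb⟩ := exists_ne_zero_forall_isUniformiser (Algebra.adjoin k {t})
    (IntermediateField.adjoin k {t}) (integralClosure (Algebra.adjoin k {t}) K) K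
  refine (finite_lt_one ht hb0).subset ?_
  rintro v ⟨⟨hv, hk⟩, htv, hram⟩
  refine ⟨⟨hv, hk⟩, htv, ?_⟩
  have hB := integralClosure_adjoin_le hk htv
  by_contra hbv
  refine hram ?_
  obtain ⟨f, hf⟩ := hb v hv hB hbv
  exact ⟨f, IntermediateField.algebra_adjoin_le_adjoin k {t} f.2, hf⟩

theorem IsSeparating.inv (ht : IsSeparating k t) : IsSeparating k t⁻¹ := by
  obtain ⟨htr, hfd, hsep⟩ := ht
  have heq : IntermediateField.adjoin k {t⁻¹} = IntermediateField.adjoin k {t} := by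
    refine le_antisymm (IntermediateField.adjoin_le_iff.2 ?_)
      (IntermediateField.adjoin_le_iff.2 ?_) <;> rw [Set.singleton_subset_iff]
    · exact inv_mem (IntermediateField.mem_adjoin_simple_self k t)
    · simpa using inv_mem (IntermediateField.mem_adjoin_simple_self k t⁻¹)
  refine ⟨fun h ↦ htr (by simpa using h.inv), ?_, ?_⟩
  · rwa [heq]
  · rwa [heq]

theorem finite_ramified (ht : IsSeparating k t) :
    {v : ValuationSubring K | IsPlace (algebraMap k K) v ∧ ¬ UnramifiedOver k t v}.Finite := by
  have ht0 : t ≠ 0 := by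
    rintro rfl
    exact ht.1 isAlgebraic_zero
  have hpole := finite_lt_one ht.inv (b := algebraMap (Algebra.adjoin k {t⁻¹}) _
    ⟨t⁻¹, Algebra.self_mem_adjoin_singleton k t⁻¹⟩) (by
      intro h
      exact inv_ne_zero ht0 (congrArg (algebraMap _ K) h))
  refine ((finite_ramified_of_mem ht).union hpole).subset ?_
  rintro v ⟨hv, hram⟩
  by_cases htv : t ∈ v
  · exact .inl ⟨hv, htv, hram⟩
  · have hlt : v.valuation t⁻¹ < 1 := by
      rw [map_inv₀]
      exact inv_lt_one_of_one_lt₀ (by rwa [← ValuationSubring.valuation_le_one_iff, not_le] at htv)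
    exact .inr ⟨hv, (v.valuation_le_one_iff _).1 hlt.le, hlt⟩

end FunctionField

/-- Lemma 5.8: if `t` is a separating element of a global function
field `K/k` of characteristic `p` and the place `v` does not ramify over `k(t)`, then the
completion `K̂_v` satisfies `UR(t)`; moreover only finitely many places ramify over
`k(t)`. -/
theorem URt_of_unramified (k K : Type) [Field k] [Finite k] [Field K] [Algebra k K]
    (hK : IsFunctionField k K) (p : ℕ) (hp : p.Prime) (hchar : CharP K p)
    (t : K) (ht : IsSeparating k t) :
    (∀ v : Places k K, UnramifiedOver k t v.1 →
      URt (cmplO K v.1) p (cmplEmb K v.1 t))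
    ∧ {v : Places k K | ¬ UnramifiedOver k t v.1}.Finite := by
  have : Fact p.Prime := ⟨hp⟩
  have : CharP k p := (algebraMap k K).charP (algebraMap k K).injective p
  refine ⟨fun ⟨v, hv, hk⟩ ⟨d, hd, hu⟩ ↦ ?_, ?_⟩
  · let _ : Algebra k (Cmpl K v) := ((cmplEmb K v).comp (algebraMap k K)).toAlgebra
    let φ : K →ₐ[k] Cmpl K v := { cmplEmb K v with commutes' := fun _ ↦ rfl }
    refine URt_of_mem_adjoin (k := k) (d := cmplEmb K v d) (fun c ↦ cmplEmb_mem_cmplO (hk c)) ?_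
      hu.cmplEmb ((map_ne_zero _).2 (hu.ne_zero hv))
    have := IntermediateField.adjoin_map k {t} φ
    rw [Set.image_singleton] at this
    exact this.le ⟨d, hd, rfl⟩
  · refine Set.Finite.of_finite_image (f := Subtype.val) ((finite_ramified ht).subset ?_)
      Subtype.val_injective.injOn
    rintro _ ⟨v, hv, rfl⟩
    exact ⟨v.2, hv⟩
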